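/- Fix integers m ≥ 2 and k with 1 ≤ k ≤ m − 1. Let F : cube₊^{m−k} × cube₊^{k} → cube₊^{m} be the projection functor that sends a pair of vertices (v, w) to the concatenated vertex vw ∈ {0,1}^m, sends every pair having the basepoint ∗ in either coordinate to the basepoint ∗ of cube₊^{m}, and acts in the induced way on morphisms. Then F is a final (cofinal) functor: for every object d of cube₊^{m}, the comma category d ↓ F — whose objects are pairs (c, f) with c an object of cube₊^{m−k} × cube₊^{k} and f : d → F(c) a morphism in cube₊^{m}, and whose morphisms are morphisms in the product category commuting with the structure maps — is nonempty and connected. -/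

import Mathlib

open CategoryTheory

/-- Objects of the based cube category `cube₊^N`: the vertices `v ∈ {0,1}^N`
(encoded as `some v` for `v : Fin N → Bool`) together with one extra basepoint
object `∗` (encoded as `none`). -/
def BasedCube (N : ℕ) : Type := Option (Fin N → Bool)

namespace BasedCube

/-- The morphism relation of the based cube category: there is a (unique) morphism
`v → w` between vertices iff `v ≤ w` coordinatewise, a (unique) morphism `v → ∗`
iff `v` is not the top vertex `(1,…,1)`, the identity morphism `∗ → ∗`, and no
morphism out of `∗` to a vertex. -/
def Rel {N : ℕ} : BasedCube N → BasedCube N → Prop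
  | some v, some w => ∀ i, v i ≤ w i
  | some v, none => ¬ ∀ i, v i = true
  | none, some _ => False
  | none, none => True

theorem Rel.refl {N : ℕ} (x : BasedCube N) : Rel x x := by
  cases x with
  | none => trivial
  | some v => exact fun i => le_refl _

theorem Rel.trans {N : ℕ} {x y z : BasedCube N} (h1 : Rel x y) (h2 : Rel y z) :
    Rel x z := by
  cases x <;> cases y <;> cases z <;>
    first
      | trivial
      | exact h1.elim
      | exact h2.elim
      | exact h1
      | exact fun i => le_trans (h1 i) (h2 i)
      | exact fun hv =>
          h2 fun i => le_antisymm (Bool.le_true _) (by rw [← hv i]; exact h1 i)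

/-- The based cube category `cube₊^N`, with a unique morphism `x → y` whenever
`Rel x y` holds. -/
instance instCategory (N : ℕ) : Category (BasedCube N) where
  Hom x y := PLift (Rel x y)
  id x := ⟨Rel.refl x⟩
  comp f g := ⟨f.down.trans g.down⟩
  id_comp _ := rfl
  comp_id _ := rfl
  assoc _ _ _ := rfl

/-- Concatenation of a vertex of `{0,1}^(m-k)` with a vertex of `{0,1}^k` into a
vertex of `{0,1}^m` (given `k ≤ m`). -/
def concat {m k : ℕ} (h : k ≤ m) (v : Fin (m - k) → Bool) (w : Fin k → Bool) :
    Fin m → Bool := fun i =>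
  if hi : (i : ℕ) < m - k then v ⟨i, hi⟩
  else w ⟨(i : ℕ) - (m - k), by have := i.isLt; omega⟩

theorem concat_left {m k : ℕ} (h : k ≤ m) (v : Fin (m - k) → Bool)
    (w : Fin k → Bool) (j : Fin (m - k)) (hj : (j : ℕ) < m) :
    concat h v w ⟨(j : ℕ), hj⟩ = v j := by
  have hlt : ((⟨(j : ℕ), hj⟩ : Fin m) : ℕ) < m - k := j.isLt
  simp only [concat]
  rw [dif_pos hlt]

theorem concat_right {m k : ℕ} (h : k ≤ m) (v : Fin (m - k) → Bool)
    (w : Fin k → Bool) (j : Fin k) (hj : m - k + (j : ℕ) < m) :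
    concat h v w ⟨m - k + (j : ℕ), hj⟩ = w j := by
  have hlt : ¬ ((⟨m - k + (j : ℕ), hj⟩ : Fin m) : ℕ) < m - k := by
    show ¬ (m - k + (j : ℕ) < m - k); omega
  simp only [concat]
  rw [dif_neg hlt]
  congr 1
  ext
  show m - k + (j : ℕ) - (m - k) = (j : ℕ)
  omega

/-- The projection functor `cube₊^(m-k) × cube₊^k ⥤ cube₊^m`: a pair of vertices
`(v, w)` is sent to the concatenated vertex `vw`, and any pair having the basepoint
`∗` in either coordinate is sent to the basepoint `∗`. -/
def proj (m k : ℕ) (h : k ≤ m) : BasedCube (m - k) × BasedCube k ⥤ BasedCube m where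
  obj x :=
    match x with
    | (some v, some w) => some (concat h v w)
    | (some _, none) => none
    | (none, _) => none
  map {x y} f := PLift.up <| by
    obtain ⟨x1, x2⟩ := x
    obtain ⟨y1, y2⟩ := y
    have h1 : Rel x1 y1 := f.1.down
    have h2 : Rel x2 y2 := f.2.down
    clear f
    cases x1 with
    | none =>
      cases y1 with
      | some _ => exact h1.elim
      | none => cases y2 <;> cases x2 <;> trivial
    | some v =>
      cases x2 with
      | none =>
        cases y2 with
        | some _ => exact h2.elim
        | none => cases y1 <;> trivial
      | some w =>
        cases y1 with
        | none =>
          cases y2 <;>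
            exact fun hall =>
              h1 fun j =>
                (concat_left h v w j (by have := j.isLt; omega)).symm.trans
                  (hall ⟨(j : ℕ), by have := j.isLt; omega⟩)
        | some v' =>
          cases y2 with
          | none =>
            exact fun hall =>
              h2 fun j =>
                (concat_right h v w j (by have := j.isLt; omega)).symm.trans
                  (hall ⟨m - k + (j : ℕ), by have := j.isLt; omega⟩)
          | some w' =>
            intro i
            by_cases hi : (i : ℕ) < m - k
            · show concat h v w i ≤ concat h v' w' i
              simp only [concat]
              rw [dif_pos hi, dif_pos hi]
              exact h1 ⟨(i : ℕ), hi⟩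
            · show concat h v w i ≤ concat h v' w' i
              simp only [concat]
              rw [dif_neg hi, dif_neg hi]
              exact h2 ⟨(i : ℕ) - (m - k), by have := i.isLt; omega⟩
  map_id _ := rfl
  map_comp _ _ := rfl

instance instIsThin (N : ℕ) : Quiver.IsThin (BasedCube N) :=
  fun _ _ => ⟨fun ⟨_⟩ ⟨_⟩ => rfl⟩

theorem Rel.bot_left {N : ℕ} (v : Fin N → Bool) :
    Rel (some fun _ => false : BasedCube N) (some v) :=
  fun i => Bool.false_le (v i)

theorem Rel.bot_none {N : ℕ} (hN : 0 < N) :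
    Rel (some fun _ => false : BasedCube N) none :=
  fun h => Bool.false_ne_true (h ⟨0, hN⟩)

section Concat

variable {m k : ℕ} (h : k ≤ m)

theorem exists_concat_eq (u : Fin m → Bool) : ∃ v w, concat h v w = u := by
  refine ⟨fun i => u ⟨i, by omega⟩, fun j => u ⟨m - k + j, by omega⟩, ?_⟩
  funext i
  by_cases hi : (i : ℕ) < m - k
  · simp [concat, hi]
  · simp only [concat, dif_neg hi]
    congr 1
    ext
    show m - k + ((i : ℕ) - (m - k)) = i
    omega

theorem le_left_of_concat_le {v v' : Fin (m - k) → Bool} {w w' : Fin k → Bool}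
    (hle : ∀ i, concat h v w i ≤ concat h v' w' i) (j : Fin (m - k)) : v j ≤ v' j := by
  have hj : (j : ℕ) < m := by omega
  simpa only [concat_left] using hle ⟨j, hj⟩

theorem le_right_of_concat_le {v v' : Fin (m - k) → Bool} {w w' : Fin k → Bool}
    (hle : ∀ i, concat h v w i ≤ concat h v' w' i) (j : Fin k) : w j ≤ w' j := by
  have hj : m - k + (j : ℕ) < m := by omega
  simpa only [concat_right] using hle ⟨m - k + j, hj⟩

theorem concat_eq_true {v : Fin (m - k) → Bool} {w : Fin k → Bool}
    (hv : ∀ i, v i = true) (hw : ∀ j, w j = true) (i : Fin m) : concat h v w i = true := by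
  unfold concat
  split
  · exact hv _
  · exact hw _

end Concat

section Zigzag

variable {m k : ℕ} {h : k ≤ m} {d : BasedCube m}

/-- The structured arrow from `d` to `proj m k h` at the pair `(x, y)`. -/
abbrev arrowMk (x : BasedCube (m - k)) (y : BasedCube k)
    (f : Rel d ((proj m k h).obj (x, y))) : StructuredArrow d (proj m k h) :=
  StructuredArrow.mk (Y := (x, y)) ⟨f⟩

theorem zigzag_of_rel {x x' : BasedCube (m - k)} {y y' : BasedCube k}
    (f : Rel d ((proj m k h).obj (x, y))) (f' : Rel d ((proj m k h).obj (x', y')))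
    (hx : Rel x x') (hy : Rel y y') :
    Zigzag (arrowMk x y f) (arrowMk x' y' f') :=
  Zigzag.of_hom (StructuredArrow.homMk (Prod.mkHom ⟨hx⟩ ⟨hy⟩) (Subsingleton.elim _ _))

theorem zigzag_none_left (hk : 0 < k) (hd : Rel d none) (y : BasedCube k) :
    Zigzag (arrowMk (h := h) none y hd) (arrowMk none none hd) := by
  cases y with
  | none => exact Zigzag.refl _
  | some w =>
    exact (zigzag_of_rel hd hd (Rel.refl _) (Rel.bot_left w)).symm.trans
      (zigzag_of_rel hd hd (Rel.refl _) (Rel.bot_none hk))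

theorem zigzag_some_none (hmk : 0 < m - k) (hd : Rel d none) (v : Fin (m - k) → Bool) :
    Zigzag (arrowMk (h := h) (some v) none hd) (arrowMk none none hd) :=
  (zigzag_of_rel (x := some fun _ => false) hd hd (Rel.bot_left v) (Rel.refl _)).symm.trans
    (zigzag_of_rel hd hd (Rel.bot_none hmk) (Rel.refl _))

theorem zigzag_concat (hk : 0 < k) (hmk : 0 < m - k)
    (v : Fin (m - k) → Bool) (w : Fin k → Bool)
    (hd : Rel ((proj m k h).obj (some v, some w)) none) :
    Zigzag (arrowMk (h := h) (some v) (some w) (Rel.refl _))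
      (arrowMk none none hd) := by
  by_cases hv : Rel (some v) none
  · exact (zigzag_of_rel _ hd hv (Rel.refl _)).trans (zigzag_none_left hk hd (some w))
  · have hw : Rel (some w) none := fun hw => hd (concat_eq_true h (not_not.mp hv) hw)
    exact (zigzag_of_rel _ hd (Rel.refl _) hw).trans (zigzag_some_none hmk hd v)

end Zigzag

theorem eq_none_or_exists_eq_proj_obj {m k : ℕ} (h : k ≤ m) (d : BasedCube m) :
    d = none ∨ ∃ v w, d = (proj m k h).obj (some v, some w) := by
  cases d with
  | none => exact Or.inl rfl
  | some u =>
    obtain ⟨v, w, rfl⟩ := exists_concat_eq h u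
    exact Or.inr ⟨v, w, rfl⟩

theorem exists_forall_zigzag {m k : ℕ} (h : k ≤ m) (hk : 0 < k) (hmk : 0 < m - k)
    (d : BasedCube m) : ∃ c : StructuredArrow d (proj m k h), ∀ a, Zigzag a c := by
  obtain rfl | ⟨v, w, rfl⟩ := eq_none_or_exists_eq_proj_obj h d
  · refine ⟨arrowMk none none trivial, fun a => ?_⟩
    obtain ⟨⟨x, y⟩, ⟨f⟩, rfl⟩ := a.mk_surjective
    cases x with
    | none => exact zigzag_none_left hk f y
    | some v =>
      cases y with
      | none => exact zigzag_some_none hmk f v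
      | some w => exact f.elim
  · refine ⟨arrowMk (some v) (some w) (Rel.refl _), fun a => ?_⟩
    obtain ⟨⟨x, y⟩, ⟨f⟩, rfl⟩ := a.mk_surjective
    cases x with
    | none => exact (zigzag_none_left hk f y).trans (zigzag_concat hk hmk v w f).symm
    | some v' =>
      cases y with
      | none => exact (zigzag_some_none hmk f v').trans (zigzag_concat hk hmk v w f).symm
      | some w' =>
        have hv : Rel (some v) (some v') := le_left_of_concat_le h f
        have hw : Rel (some w) (some w') := le_right_of_concat_le h f
        exact (zigzag_of_rel _ f hv hw).symm

/-- For `m ≥ 2` and `1 ≤ k ≤ m − 1`, the projection functor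
`cube₊^(m−k) × cube₊^k → cube₊^m` is final: for every object `d` of `cube₊^m` the
comma category `d ↓ F` (the category of structured arrows from `d` to `F`) is
nonempty and connected. -/
theorem proj_final (m k : ℕ) (hm : 2 ≤ m) (hk1 : 1 ≤ k) (hk2 : k ≤ m - 1) :
    (proj m k (by omega)).Final := by
  refine ⟨fun d => ?_⟩
  obtain ⟨c, hc⟩ := exists_forall_zigzag (by omega : k ≤ m) hk1 (by omega) d
  have : Nonempty (StructuredArrow d (proj m k (by omega))) := ⟨c⟩
  exact zigzag_isConnected fun a b => (hc a).trans (hc b).symm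

end BasedCube
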